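/- arXiv:2507.17724 — 2 statements merged into one kernel-verified Lean document; each statement's English description precedes it below -/
import Mathlib

section
/- If A is a bounded quasi-implication algebra, then with x* := x·0 and x ⊕ y := ((x·y)·(y·x))·x, one has (x* ⊕ y*)* = ((x·y)·(x·0))·0 for all x, y; that is, the greatest lower bound x ⊙ y := (x* ⊕ y*)* equals ((x·y)·(x·0))·0. -/
/-- In a bounded quasi-implication algebra, with `x* := x·0` and
`x ⊕ y := ((x·y)·(y·x))·x`, one has `(x* ⊕ y*)* = ((x·y)·(x·0))·0`. -/
theorem boundedQuasiImplicationAlgebra_meet_formula {A : Type*}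
    (op : A → A → A) (one zero : A)
    (Q1 : ∀ x y : A, op (op x y) x = x)
    (Q2 : ∀ x y z : A, op (op x y) (op x z) = op (op y x) (op y z))
    (Q3 : ∀ x y : A, op (op (op x y) (op y x)) x = op (op (op y x) (op x y)) y)
    (hone : ∀ x : A, op x x = one)
    (hzero : ∀ x : A, op zero x = one)
    (star : A → A) (hstar : ∀ x : A, star x = op x zero)
    (oplus : A → A → A) (hoplus : ∀ x y : A, oplus x y = op (op (op x y) (op y x)) x) :
    ∀ x y : A, star (oplus (star x) (star y)) = op (op (op x y) (op x zero)) zero := by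
  have one_op (x : A) : op one x = x := by rw [← hone x]; exact Q1 x x
  have op_one (x : A) : op x one = one := by simpa only [one_op] using Q1 one x
  have star_star (x : A) : op (op x zero) zero = x := by
    simpa only [hzero, op_one, one_op] using (Q3 x zero).symm
  have op_op_self (x y : A) : op x (op x y) = op x y := by
    simpa only [Q1] using Q1 (op x y) x
  have op_op_of_le {x y : A} (h : op x y = one) : op (op y x) x = y := by
    simpa only [h, one_op, op_one] using Q3 x y
  have antisymm {x y : A} (h : op x y = one) (h' : op y x = one) : x = y := by
    simpa only [h, h', one_op] using Q3 x y
  have trans {x y z : A} (h : op x y = one) (h' : op y z = one) : op x z = one := by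
    simpa only [h, h', one_op, op_one] using Q2 x y z
  have star_le (x y : A) : op (op x zero) (op x y) = one := by
    simpa only [hzero, hone] using Q2 x zero y
  have le_op {a b : A} (h : op b a = one) : op b (op a b) = one := by
    simpa only [h, one_op, op_op_self, hone] using Q2 b a (op a b)
  have star_anti {x y : A} (h : op x y = one) : op (op y zero) (op x zero) = one := by
    have e : op x zero = op (op y x) (op y zero) := by
      simpa only [h, one_op] using Q2 x y zero
    rw [e]
    exact le_op (star_le y x)
  have op_anti {r p q : A} (hr : op r p = one) (h : op p q = one) :
      op (op q r) (op p r) = one := by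
    have e : op p r = op (op q p) (op q r) := by
      simpa only [h, one_op] using Q2 p q r
    rw [e]
    apply le_op
    rw [Q2, trans hr h, hr, hone]
  have le_comm (a b : A) : op a (op (op a b) (op b a)) = one := by
    have e := Q2 (op a b) a (op b a)
    rw [Q1, op_op_self, Q2 a b (op b a), op_op_self, hone] at e
    exact e
  have le_join_left (a b : A) : op a (op (op (op a b) (op b a)) a) = one :=
    le_op (le_comm a b)
  have le_join_right (a b : A) : op b (op (op (op a b) (op b a)) a) = one := by
    rw [Q3]; exact le_join_left b a
  have join_le {a b z : A} (ha : op a z = one) (hb : op b z = one) :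
      op (op (op (op a b) (op b a)) a) z = one := by
    have eab : op a b = op (op z a) (op z b) := by
      simpa only [ha, one_op] using Q2 a z b
    have eba : op b a = op (op z b) (op z a) := by
      simpa only [hb, one_op] using Q2 b z a
    have h : op (op z a) (op (op a b) (op b a)) = one := by
      rw [eab, eba]; exact le_comm _ _
    simpa only [op_op_of_le ha] using op_anti (le_op ha) h
  have star_le_meet (x y : A) : op (op x zero) (op (op x y) (op x zero)) = one :=
    le_op (star_le x y)
  have meet_le {x y t : A} (hx : op t x = one) (hy : op t y = one) :
      op (op (op x y) (op x zero)) (op t zero) = one := by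
    have e : op t zero = op (op x t) (op x zero) := by
      simpa only [hx, one_op] using Q2 t x zero
    rw [e]
    apply op_anti (star_le x t)
    rw [Q2, hx, hy, hone]
  intro x y
  rw [hstar, hstar, hstar, hoplus]
  congr 1
  apply antisymm
  · apply join_le (star_le_meet x y)
    rw [Q2]
    exact star_le_meet y x
  · have hx := star_anti (le_join_left (op x zero) (op y zero))
    have hy := star_anti (le_join_right (op x zero) (op y zero))
    rw [star_star] at hx hy
    simpa only [star_star] using meet_le hx hy
end

section
/- If A is a monadic quasi-implication algebra, then with x* := x·0, x ⊕ y := ((x·y)·(y·x))·x, and x ⊙ y := (x* ⊕ y*)*, the structure (A, ⊙, ⊕, *, 0, 1, ◇) is a quantum monadic algebra: (A, ⊙, ⊕, *, 0, 1) is an orthomodular lattice and ◇ is a quantifier on it, i.e. ◇0 = 0, x ≼ ◇x, ◇(x ⊕ y) = ◇x ⊕ ◇y, ◇◇x = ◇x, and ◇((◇x)*) = (◇x)* for all x, y (where x ≼ y iff x·y = 1). -/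
/-- `op` is the operation of a bounded quasi-implication algebra with top element `one` and
bottom element `zero`. The order is given by `op x y = one`, the orthocomplement by
`op x zero`. -/
structure IsBoundedQuasiImplication {A : Type*} (op : A → A → A) (one zero : A) : Prop where
  op_op_self : ∀ x y : A, op (op x y) x = x
  op_op_op : ∀ x y z : A, op (op x y) (op x z) = op (op y x) (op y z)
  op_op_comm : ∀ x y : A, op (op (op x y) (op y x)) x = op (op (op y x) (op x y)) y
  self_op_self : ∀ x : A, op x x = one
  zero_op : ∀ x : A, op zero x = one

namespace IsBoundedQuasiImplication

variable {A : Type*} {op : A → A → A} {one zero : A}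

local infixl:70 " ⬝ " => op

/-! ### The order -/

theorem one_op (h : IsBoundedQuasiImplication op one zero) (x : A) : one ⬝ x = x := by
  rw [← h.self_op_self x, h.op_op_self]

theorem op_op_left_self (h : IsBoundedQuasiImplication op one zero) (x y : A) :
    x ⬝ (x ⬝ y) = x ⬝ y := by
  simpa only [h.op_op_self] using h.op_op_self (x ⬝ y) x

theorem op_one (h : IsBoundedQuasiImplication op one zero) (x : A) : x ⬝ one = one := by
  rw [← h.self_op_self x, h.op_op_left_self]

theorem antisymm (h : IsBoundedQuasiImplication op one zero) {x y : A}
    (hxy : x ⬝ y = one) (hyx : y ⬝ x = one) : x = y := by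
  simpa only [hxy, hyx, h.one_op] using h.op_op_comm x y

theorem op_eq_of_le (h : IsBoundedQuasiImplication op one zero) {x y : A}
    (hxy : x ⬝ y = one) (z : A) : x ⬝ z = (y ⬝ x) ⬝ (y ⬝ z) := by
  rw [← h.op_op_op, hxy, h.one_op]

theorem trans (h : IsBoundedQuasiImplication op one zero) {x y z : A}
    (hxy : x ⬝ y = one) (hyz : y ⬝ z = one) : x ⬝ z = one := by
  rw [h.op_eq_of_le hxy, hyz, h.op_one]

theorem op_mono_right (h : IsBoundedQuasiImplication op one zero) (x : A) {y z : A}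
    (hyz : y ⬝ z = one) : (x ⬝ y) ⬝ (x ⬝ z) = one := by
  rw [h.op_op_op, hyz, h.op_one]

theorem le_op_of_le (h : IsBoundedQuasiImplication op one zero) {x y : A}
    (hxy : x ⬝ y = one) : x ⬝ (y ⬝ x) = one := by
  rw [h.op_eq_of_le hxy, h.op_op_left_self, h.self_op_self]

theorem op_anti_left (h : IsBoundedQuasiImplication op one zero) {x y z : A}
    (hxy : x ⬝ y = one) (hyz : y ⬝ z = one) : (z ⬝ x) ⬝ (y ⬝ x) = one := by
  rw [h.op_eq_of_le hyz x]
  exact h.le_op_of_le (h.op_mono_right z hxy)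

theorem op_op_eq_of_le (h : IsBoundedQuasiImplication op one zero) {x y : A}
    (hxy : x ⬝ y = one) : (y ⬝ x) ⬝ x = y := by
  simpa only [hxy, h.one_op, h.op_one, h.op_op_self] using h.op_op_comm x y

/-! ### The orthocomplement -/

theorem compl_le_op (h : IsBoundedQuasiImplication op one zero) (x y : A) :
    (x ⬝ zero) ⬝ (x ⬝ y) = one :=
  h.op_mono_right x (h.zero_op y)

theorem compl_compl (h : IsBoundedQuasiImplication op one zero) (x : A) :
    (x ⬝ zero) ⬝ zero = x :=
  h.op_op_eq_of_le (h.zero_op x)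

theorem compl_anti (h : IsBoundedQuasiImplication op one zero) {x y : A}
    (hxy : x ⬝ y = one) : (y ⬝ zero) ⬝ (x ⬝ zero) = one :=
  h.op_anti_left (h.zero_op x) hxy

theorem compl_op_self (h : IsBoundedQuasiImplication op one zero) (x : A) :
    (x ⬝ zero) ⬝ x = x := by
  simpa only [h.compl_compl] using h.op_op_left_self (x ⬝ zero) zero

theorem le_compl_op (h : IsBoundedQuasiImplication op one zero) (x y : A) :
    x ⬝ ((x ⬝ zero) ⬝ y) = one := by
  simpa only [h.compl_compl] using h.compl_le_op (x ⬝ zero) y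

theorem compl_op_of_le (h : IsBoundedQuasiImplication op one zero) {x y : A}
    (hxy : x ⬝ y = one) : (x ⬝ zero) ⬝ y = y := by
  have hcomm : (y ⬝ zero) ⬝ x = (x ⬝ zero) ⬝ y := by
    rw [h.op_eq_of_le (h.compl_le_op y x) x, h.op_op_eq_of_le hxy, h.op_op_op, hxy, h.one_op]
  have hle := h.op_mono_right (y ⬝ zero) hxy
  rw [h.compl_op_self, hcomm] at hle
  refine h.antisymm hle ?_
  simpa only [hcomm, h.compl_compl] using h.compl_le_op (y ⬝ zero) x

/-! ### Joins and meets -/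

theorem le_sup_left (h : IsBoundedQuasiImplication op one zero) (x y : A) :
    x ⬝ ((x ⬝ zero) ⬝ (y ⬝ zero) ⬝ x) = one :=
  h.le_op_of_le (h.le_compl_op x _)

theorem sup_comm (h : IsBoundedQuasiImplication op one zero) (x y : A) :
    (x ⬝ zero) ⬝ (y ⬝ zero) ⬝ x = (y ⬝ zero) ⬝ (x ⬝ zero) ⬝ y := by
  simpa only [h.compl_compl] using h.op_op_op (x ⬝ zero) (y ⬝ zero) zero

theorem le_sup_right (h : IsBoundedQuasiImplication op one zero) (x y : A) :
    y ⬝ ((x ⬝ zero) ⬝ (y ⬝ zero) ⬝ x) = one := by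
  rw [h.sup_comm]
  exact h.le_sup_left y x

theorem sup_le (h : IsBoundedQuasiImplication op one zero) {x y z : A}
    (hxz : x ⬝ z = one) (hyz : y ⬝ z = one) : (x ⬝ zero) ⬝ (y ⬝ zero) ⬝ x ⬝ z = one := by
  have hle := h.op_anti_left (h.le_compl_op x (z ⬝ zero))
    (h.op_mono_right (x ⬝ zero) (h.compl_anti hyz))
  rwa [h.sup_comm x z, h.compl_anti hxz, h.one_op] at hle

theorem op_eq_sup_compl (h : IsBoundedQuasiImplication op one zero) {x y : A}
    (hxy : x ⬝ y = one) : (x ⬝ zero) ⬝ ((y ⬝ zero) ⬝ zero) ⬝ x = y ⬝ x := by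
  rw [h.compl_compl, h.compl_op_of_le hxy]

theorem le_op (h : IsBoundedQuasiImplication op one zero) {x y z : A}
    (hzx : z ⬝ x = one) (hzy : z ⬝ y = one) : z ⬝ (x ⬝ y) = one :=
  h.trans (h.le_op_of_le hzx) (h.op_mono_right x hzy)

theorem inf_le_left (h : IsBoundedQuasiImplication op one zero) (x y : A) :
    (x ⬝ y ⬝ (x ⬝ zero) ⬝ zero) ⬝ x = one := by
  simpa only [h.compl_compl] using h.compl_anti (h.le_sup_left (x ⬝ zero) (y ⬝ zero))

theorem inf_le_right (h : IsBoundedQuasiImplication op one zero) (x y : A) :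
    (x ⬝ y ⬝ (x ⬝ zero) ⬝ zero) ⬝ y = one := by
  simpa only [h.compl_compl] using h.compl_anti (h.le_sup_right (x ⬝ zero) (y ⬝ zero))

theorem le_inf (h : IsBoundedQuasiImplication op one zero) {x y z : A}
    (hzx : z ⬝ x = one) (hzy : z ⬝ y = one) : z ⬝ (x ⬝ y ⬝ (x ⬝ zero) ⬝ zero) = one := by
  simpa only [h.compl_compl] using
    h.compl_anti (h.sup_le (h.compl_anti hzx) (h.compl_anti hzy))

/-- `x ⬝ y` only depends on `x` and the meet of `x` and `y`. -/
theorem op_inf (h : IsBoundedQuasiImplication op one zero) (x y : A) :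
    x ⬝ (x ⬝ y ⬝ (x ⬝ zero) ⬝ zero) = x ⬝ y := by
  have hsup := h.op_eq_sup_compl (h.le_op_of_le (h.compl_le_op x y))
  rwa [h.op_op_eq_of_le (h.compl_le_op x y), h.sup_comm,
    h.op_eq_sup_compl (h.inf_le_left x y)] at hsup

theorem op_op_op_op_eq_sup (h : IsBoundedQuasiImplication op one zero) (x y : A) :
    x ⬝ y ⬝ (y ⬝ x) ⬝ x = (x ⬝ zero) ⬝ (y ⬝ zero) ⬝ x := by
  have le_left : ∀ x y : A, x ⬝ (x ⬝ y ⬝ (y ⬝ x)) = one := by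
    intro x y
    have hle := h.op_mono_right (x ⬝ y) (h.le_op (h.inf_le_right x y) (h.inf_le_left x y))
    have hx := h.op_op_eq_of_le (h.inf_le_left x y)
    rw [h.op_inf] at hx
    rwa [hx] at hle
  refine h.antisymm ?_ (h.sup_le (h.le_op_of_le (le_left x y)) ?_)
  · refine h.op_anti_left (h.le_compl_op x _) ?_
    rw [← h.op_inf (x ⬝ zero) (y ⬝ zero), ← h.op_eq_sup_compl (h.inf_le_left _ _)]
    refine h.sup_le (h.le_op ?_ ?_) ?_
    · exact h.trans (h.inf_le_left _ _) (h.compl_le_op x y)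
    · exact h.trans (h.inf_le_right _ _) (h.compl_le_op y x)
    · rw [h.compl_compl]
      exact le_left x y
  · rw [h.op_op_comm]
    exact h.le_op_of_le (le_left y x)

end IsBoundedQuasiImplication

/-- If `A` is a monadic quasi-implication algebra, then with `x* := x·0`,
`x ⊕ y := ((x·y)·(y·x))·x`, `x ⊙ y := (x* ⊕ y*)*`, the structure
`(A, ⊙, ⊕, *, 0, 1, ◇)` is a quantum monadic algebra: the lattice part is an
orthomodular lattice and `◇` is a quantifier on it. -/
theorem monadicQuasiImplicationAlgebra_toQuantumMonadicAlgebra {A : Type*}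
    (op : A → A → A) (one zero : A) (d : A → A)
    (Q1 : ∀ x y : A, op (op x y) x = x)
    (Q2 : ∀ x y z : A, op (op x y) (op x z) = op (op y x) (op y z))
    (Q3 : ∀ x y : A, op (op (op x y) (op y x)) x = op (op (op y x) (op x y)) y)
    (hone : ∀ x : A, op x x = one)
    (hzero : ∀ x : A, op zero x = one)
    (ha1 : ∀ x : A, op (d (d x)) (d x) = one)
    (ha2 : ∀ x : A, op x (d x) = one)
    (hb1 : ∀ x : A, d (op (d x) zero) = op (d x) zero)
    (hb2 : d zero = zero)
    (hc : ∀ x y : A, d (op (op (op x zero) (op y zero)) x)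
        = op (op (op (d x) zero) (op (d y) zero)) (d x))
    (star : A → A) (hstar : ∀ x : A, star x = op x zero)
    (oplus : A → A → A) (hoplus : ∀ x y : A, oplus x y = op (op (op x y) (op y x)) x)
    (odot : A → A → A) (hodot : ∀ x y : A, odot x y = star (oplus (star x) (star y))) :
    -- (A, ⊙, ⊕, *, 0, 1) is an orthomodular lattice w.r.t. x ≼ y iff x·y = 1
    (∀ x y : A, op x (oplus x y) = one ∧ op y (oplus x y) = one ∧
      ∀ z : A, op x z = one → op y z = one → op (oplus x y) z = one) ∧
    (∀ x y : A, op (odot x y) x = one ∧ op (odot x y) y = one ∧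
      ∀ z : A, op z x = one → op z y = one → op z (odot x y) = one) ∧
    (∀ x : A, op zero x = one) ∧ (∀ x : A, op x one = one) ∧
    (∀ x : A, odot x (star x) = zero) ∧
    (∀ x : A, oplus x (star x) = one) ∧
    (∀ x y : A, op x y = one → op (star y) (star x) = one) ∧
    (∀ x : A, star (star x) = x) ∧
    (∀ x y : A, op x y = one → y = oplus x (odot (star x) y)) ∧
    -- ◇ is a quantifier
    d zero = zero ∧
    (∀ x : A, op x (d x) = one) ∧
    (∀ x y : A, d (oplus x y) = oplus (d x) (d y)) ∧
    (∀ x : A, d (d x) = d x) ∧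
    (∀ x : A, d (star (d x)) = star (d x)) := by
  have h : IsBoundedQuasiImplication op one zero := ⟨Q1, Q2, Q3, hone, hzero⟩
  have hsup : ∀ x y : A, oplus x y = op (op (op x zero) (op y zero)) x := fun x y => by
    rw [hoplus, h.op_op_op_op_eq_sup]
  have hinf : ∀ x y : A, odot x y = op (op (op x y) (op x zero)) zero := fun x y => by
    simp only [hodot, hstar, hsup, h.compl_compl]
  have hsup_compl : ∀ x : A, oplus x (op x zero) = one := fun x => by
    rw [hsup, h.compl_compl, h.compl_op_self, hone]
  simp only [hstar]
  refine ⟨fun x y => ?_, fun x y => ?_, hzero, h.op_one, fun x => ?_, hsup_compl,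
    fun x y => h.compl_anti, h.compl_compl, fun x y hxy => ?_, hb2, ha2, fun x y => ?_,
    fun x => h.antisymm (ha1 x) (ha2 (d x)), hb1⟩
  · rw [hsup]
    exact ⟨h.le_sup_left x y, h.le_sup_right x y, fun z => h.sup_le⟩
  · rw [hinf]
    exact ⟨h.inf_le_left x y, h.inf_le_right x y, fun z => h.le_inf⟩
  · rw [hodot, hstar, hstar, hstar, hsup_compl, h.one_op]
  · rw [hodot, hstar, hstar, hstar, h.compl_compl, hsup, hsup, h.op_eq_sup_compl hxy,
      h.op_eq_sup_compl (h.le_op_of_le hxy), h.op_op_eq_of_le hxy]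
  · rw [hsup, hsup, hc]
end
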